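/- Let (X,d) be a proper, uniquely geodesic, geodesically complete metric space in which geodesics do not split, and let J be a surjective isometry of the space 𝔉(X,d) of nonempty compact subsets of X endowed with the Hausdorff metric d_H such that J({p}) = {p} for every p ∈ X. Then for every p ∈ X, every r > 0, and every nonempty finite subset S of the sphere S_r(p) = { x ∈ X | d(x,p) = r }, it holds that J(S) = S. -/

import Mathlib

open Metric Set TopologicalSpace

variable {X : Type*}

/-- A geodesic segment from `x` to `y`, parametrized by arclength on `[0, dist x y]`. -/
def IsGeodesicSegment [MetricSpace X] (γ : ℝ → X) (x y : X) : Prop :=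
  γ 0 = x ∧ γ (dist x y) = y ∧
    ∀ s ∈ Set.Icc (0 : ℝ) (dist x y), ∀ t ∈ Set.Icc (0 : ℝ) (dist x y),
      dist (γ s) (γ t) = |s - t|

/-- A metric space is geodesic if any two points are joined by a geodesic segment. -/
def IsGeodesicSpace (X : Type*) [MetricSpace X] : Prop :=
  ∀ x y : X, ∃ γ : ℝ → X, IsGeodesicSegment γ x y

/-- A metric space is uniquely geodesic if any two points are joined by a geodesic
segment, which is moreover unique (as a parametrized segment). -/
def IsUniquelyGeodesic (X : Type*) [MetricSpace X] : Prop :=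
  ∀ x y : X, (∃ γ : ℝ → X, IsGeodesicSegment γ x y) ∧
    ∀ γ γ' : ℝ → X, IsGeodesicSegment γ x y → IsGeodesicSegment γ' x y →
      ∀ t ∈ Set.Icc (0 : ℝ) (dist x y), γ t = γ' t

/-- Geodesic completeness: every geodesic segment extends to a full geodesic line,
i.e. an isometric embedding of `ℝ`. -/
def IsGeodesicallyComplete (X : Type*) [MetricSpace X] : Prop :=
  ∀ (x y : X) (γ : ℝ → X), IsGeodesicSegment γ x y →
    ∃ γ' : ℝ → X, Isometry γ' ∧ γ '' Set.Icc (0 : ℝ) (dist x y) ⊆ Set.range γ'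

/-- Geodesics do not split: the image of the bi-infinite geodesic extension of every
nondegenerate geodesic segment is unique. -/
def GeodesicsDoNotSplit (X : Type*) [MetricSpace X] : Prop :=
  ∀ (x y : X) (γ : ℝ → X), IsGeodesicSegment γ x y → x ≠ y →
    ∀ γ₁ γ₂ : ℝ → X, Isometry γ₁ → Isometry γ₂ →
      γ '' Set.Icc (0 : ℝ) (dist x y) ⊆ Set.range γ₁ →
      γ '' Set.Icc (0 : ℝ) (dist x y) ⊆ Set.range γ₂ →
      Set.range γ₁ = Set.range γ₂

/-- A subset is (geodesically) convex if with any two of its points it contains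
the image of every geodesic segment joining them. -/
def IsGeodConvex [MetricSpace X] (C : Set X) : Prop :=
  ∀ a ∈ C, ∀ b ∈ C, ∀ γ : ℝ → X, IsGeodesicSegment γ a b →
    γ '' Set.Icc (0 : ℝ) (dist a b) ⊆ C

/-- A midpoint map on a metric space: a symmetric map `m` with
`d(m(x,y),x) = d(x,y)/2 = d(m(x,y),y)`. -/
def IsMidpointMap [MetricSpace X] (m : X → X → X) : Prop :=
  (∀ x y, m x y = m y x) ∧
    ∀ x y, dist (m x y) x = dist x y / 2 ∧ dist (m x y) y = dist x y / 2

/-- A convex midpoint map: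
`d(m(x₁,y₁), m(x₂,y₂)) ≤ (d(x₁,x₂) + d(y₁,y₂))/2` for all points. -/
def IsConvexMidpointMap [MetricSpace X] (m : X → X → X) : Prop :=
  IsMidpointMap m ∧
    ∀ x₁ x₂ y₁ y₂ : X, dist (m x₁ y₁) (m x₂ y₂) ≤ (dist x₁ x₂ + dist y₁ y₂) / 2

/-- The space `𝒞(X,d)` of nonempty convex compact subsets of `X`, endowed with the
Hausdorff metric (as a subtype of `NonemptyCompacts X`, whose metric is the
Hausdorff distance). -/
abbrev ConvexCompacts (X : Type*) [MetricSpace X] :=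
  {A : NonemptyCompacts X // IsGeodConvex (A : Set X)}

lemma isGeodConvex_singleton [MetricSpace X] (p : X) : IsGeodConvex ({p} : Set X) := by
  rintro a ha b hb γ hγ x ⟨t, ht, rfl⟩
  rw [Set.mem_singleton_iff] at ha hb
  subst ha; subst hb
  rw [dist_self] at ht
  have : t = 0 := le_antisymm ht.2 ht.1
  subst this
  exact hγ.1

/-- The singleton `{p}` as an element of `𝒞(X,d)`. -/
def singletonCC [MetricSpace X] (p : X) : ConvexCompacts X :=
  ⟨⟨⟨{p}, isCompact_singleton⟩, Set.singleton_nonempty p⟩, isGeodConvex_singleton p⟩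

/-- The singleton `{p}` as an element of `𝔉(X,d)`, the space of nonempty compact
subsets of `X` with the Hausdorff metric. -/
def singletonNC [MetricSpace X] (p : X) : NonemptyCompacts X :=
  ⟨⟨{p}, isCompact_singleton⟩, Set.singleton_nonempty p⟩

/-- The closed `r`-neighborhood `N_r(A) = {x | ∃ a ∈ A, d(a,x) ≤ r}` of a set. -/
def closedNbhd [MetricSpace X] (r : ℝ) (A : Set X) : Set X :=
  {x : X | ∃ a ∈ A, dist a x ≤ r}

/-- A set is `m`-convex if it contains the `m`-midpoint of each pair of its points. -/
def MConvexSet [MetricSpace X] (m : X → X → X) (A : Set X) : Prop :=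
  ∀ a ∈ A, ∀ a' ∈ A, m a a' ∈ A

/-- The `m`-convex hull: the intersection of all closed `m`-convex sets containing `A`. -/
def mConvexHull [MetricSpace X] (m : X → X → X) (A : Set X) : Set X :=
  ⋂₀ {C : Set X | IsClosed C ∧ MConvexSet m C ∧ A ⊆ C}

section Lines

variable [MetricSpace X]

lemma exists_line (hug : IsUniquelyGeodesic X) (hgc : IsGeodesicallyComplete X) (x y : X) :
    ∃ γ : ℝ → X, Isometry γ ∧ γ 0 = x ∧ γ (dist x y) = y := by
  obtain ⟨γ, hγ⟩ := (hug x y).1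
  obtain ⟨σ, hσ, hsub⟩ := hgc x y γ hγ
  obtain ⟨a, ha⟩ : x ∈ Set.range σ := hsub ⟨0, ⟨le_rfl, dist_nonneg⟩, hγ.1⟩
  obtain ⟨b, hb⟩ : y ∈ Set.range σ := hsub ⟨dist x y, ⟨dist_nonneg, le_rfl⟩, hγ.2.1⟩
  have hab : dist x y = |a - b| := by rw [← ha, ← hb, hσ.dist_eq, Real.dist_eq]
  rcases le_total a b with h | h
  · refine ⟨fun t => σ (a + t), hσ.comp (IsometryEquiv.addLeft a).isometry, by simp [ha], ?_⟩
    rw [hab, abs_of_nonpos (by linarith), ← hb]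
    exact congrArg σ (by ring)
  · refine ⟨fun t => σ (a - t), hσ.comp (IsometryEquiv.subLeft a).isometry, by simp [ha], ?_⟩
    rw [hab, abs_of_nonneg (by linarith), ← hb]
    exact congrArg σ (by ring)

/-- Two geodesics meeting end to end without loss of length concatenate to a geodesic, hence
lie on a common line. -/
lemma exists_line_extending (hgc : IsGeodesicallyComplete X) {x y z : X} {α β : ℝ → X}
    (hα : Isometry α) (hα0 : α 0 = x) (hα1 : α (dist x y) = y)
    (hβ : Isometry β) (hβ0 : β 0 = y) (hβ1 : β (dist y z) = z)
    (h : dist x z = dist x y + dist y z) :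
    ∃ σ : ℝ → X, Isometry σ ∧ α '' Set.Icc 0 (dist x y) ⊆ Set.range σ ∧ z ∈ Set.range σ := by
  set a := dist x y with ha
  have ha0 : 0 ≤ a := dist_nonneg
  have hb0 : 0 ≤ dist y z := dist_nonneg
  let γ : ℝ → X := fun t => if t ≤ a then α t else β (t - a)
  have hcross : ∀ s ∈ Set.Icc (0 : ℝ) (dist x z), ∀ t ∈ Set.Icc (0 : ℝ) (dist x z),
      s ≤ a → a < t → dist (α s) (β (t - a)) = |s - t| := by
    intro s hs t ht hsa hat
    have h1 : dist (α s) y = a - s := by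
      rw [← hα1, hα.dist_eq, Real.dist_eq, abs_of_nonpos (by linarith)]; ring
    have h2 : dist y (β (t - a)) = t - a := by
      rw [← hβ0, hβ.dist_eq, Real.dist_eq, abs_of_nonpos (by linarith)]; ring
    have h3 : dist x (α s) = s := by
      rw [← hα0, hα.dist_eq, Real.dist_eq, abs_of_nonpos (by linarith [hs.1])]; ring
    have h4 : dist (β (t - a)) z = dist x z - t := by
      nth_rewrite 1 [← hβ1]
      rw [hβ.dist_eq, Real.dist_eq, abs_of_nonpos (by linarith [ht.2])]; linarith
    have h5 := dist_triangle (α s) y (β (t - a))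
    have h6 := dist_triangle4 x (α s) (β (t - a)) z
    rw [abs_of_nonpos (by linarith)]
    linarith
  have hγ : IsGeodesicSegment γ x z := by
    refine ⟨by simp [γ, ha0, hα0], ?_, ?_⟩
    · by_cases hz : dist x z ≤ a
      · have hyz : dist y z = 0 := by linarith
        have : y = z := dist_eq_zero.1 hyz
        simp only [γ, if_pos hz]
        rw [h, hyz, add_zero, hα1, this]
      · simp only [γ, if_neg hz]
        rw [h, add_sub_cancel_left, hβ1]
    · intro s hs t ht
      by_cases hsa : s ≤ a <;> by_cases hta : t ≤ a
      · simp only [γ, if_pos hsa, if_pos hta]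
        rw [hα.dist_eq, Real.dist_eq]
      · simp only [γ, if_pos hsa, if_neg hta]
        exact hcross s hs t ht hsa (not_le.1 hta)
      · simp only [γ, if_neg hsa, if_pos hta]
        rw [dist_comm, abs_sub_comm]
        exact hcross t ht s hs hta (not_le.1 hsa)
      · simp only [γ, if_neg hsa, if_neg hta]
        rw [hβ.dist_eq, Real.dist_eq]
        congr 1; ring
  obtain ⟨σ, hσ, hsub⟩ := hgc x z γ hγ
  refine ⟨σ, hσ, ?_, hsub ⟨dist x z, ⟨dist_nonneg, le_rfl⟩, hγ.2.1⟩⟩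
  rintro _ ⟨t, ht, rfl⟩
  exact hsub ⟨t, ⟨ht.1, by linarith [ht.2]⟩, by simp [γ, ht.2]⟩

lemma eq_of_dist_add_eq (hug : IsUniquelyGeodesic X) (hgc : IsGeodesicallyComplete X)
    (hns : GeodesicsDoNotSplit X) {x y z w : X} (hxy : x ≠ y)
    (hz : dist x z = dist x y + dist y z) (hw : dist x w = dist x y + dist y w)
    (hzw : dist y z = dist y w) : z = w := by
  obtain ⟨α, hα, hα0, hα1⟩ := exists_line hug hgc x y
  obtain ⟨β, hβ, hβ0, hβ1⟩ := exists_line hug hgc y z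
  obtain ⟨β', hβ', hβ0', hβ1'⟩ := exists_line hug hgc y w
  obtain ⟨σ, hσ, hsub, hzσ⟩ := exists_line_extending hgc hα hα0 hα1 hβ hβ0 hβ1 hz
  obtain ⟨σ', hσ', hsub', hwσ⟩ := exists_line_extending hgc hα hα0 hα1 hβ' hβ0' hβ1' hw
  have hseg : IsGeodesicSegment α x y :=
    ⟨hα0, hα1, fun s _ t _ => by rw [hα.dist_eq, Real.dist_eq]⟩
  rw [← hns x y α hseg hxy σ σ' hσ hσ' hsub hsub'] at hwσ
  obtain ⟨a, ha⟩ : x ∈ Set.range σ := hsub ⟨0, ⟨le_rfl, dist_nonneg⟩, hα0⟩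
  obtain ⟨b, hb⟩ : y ∈ Set.range σ := hsub ⟨dist x y, ⟨dist_nonneg, le_rfl⟩, hα1⟩
  obtain ⟨c, rfl⟩ := hzσ
  obtain ⟨d, rfl⟩ := hwσ
  subst ha hb
  have hab : a ≠ b := fun h => hxy (congrArg σ h)
  simp only [hσ.dist_eq, Real.dist_eq] at hz hw hzw
  congr 1
  rcases abs_cases (a - b) with h1 | h1 <;> rcases abs_cases (b - c) with h2 | h2 <;>
    rcases abs_cases (b - d) with h3 | h3 <;> rcases abs_cases (a - c) with h4 | h4 <;>
    rcases abs_cases (a - d) with h5 | h5 <;>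
    first
      | linarith
      | (exfalso; apply hab; linarith)

lemma isPreconnected_ball_of_geodesic (hug : IsUniquelyGeodesic X)
    (hgc : IsGeodesicallyComplete X) (p : X) (r : ℝ) : IsPreconnected (ball p r) := by
  refine isPreconnected_of_forall p fun x hx => ?_
  obtain ⟨γ, hγ, h0, h1⟩ := exists_line hug hgc p x
  refine ⟨γ '' Set.Icc 0 (dist p x), ?_, ⟨0, ⟨le_rfl, dist_nonneg⟩, h0⟩,
    ⟨dist p x, ⟨dist_nonneg, le_rfl⟩, h1⟩,
    isPreconnected_Icc.image γ hγ.continuous.continuousOn⟩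
  rintro _ ⟨t, ht, rfl⟩
  rw [mem_ball, ← h0, hγ.dist_eq, Real.dist_eq, sub_zero, abs_of_nonneg ht.1]
  rw [mem_ball, dist_comm] at hx
  exact ht.2.trans_lt hx

lemma closedBall_subset_of_ball_subset (hug : IsUniquelyGeodesic X)
    (hgc : IsGeodesicallyComplete X) {p : X} {r : ℝ} (hr : 0 < r) {A : Set X}
    (hA : IsClosed A) (h : ball p r ⊆ A) : closedBall p r ⊆ A := by
  intro x hx
  obtain ⟨γ, hγ, h0, h1⟩ := exists_line hug hgc p x
  rw [mem_closedBall, dist_comm] at hx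
  have hmaps : Set.MapsTo γ (Set.Ico 0 r) A := by
    intro t ht
    apply h
    rw [mem_ball, ← h0, hγ.dist_eq, Real.dist_eq, sub_zero, abs_of_nonneg ht.1]
    exact ht.2
  have hcl := hmaps.closure hγ.continuous
  rw [closure_Ico hr.ne, hA.closure_eq] at hcl
  rw [← h1]
  exact hcl ⟨dist_nonneg, hx⟩

end Lines

namespace TopologicalSpace.NonemptyCompacts

variable [MetricSpace X]

lemma exists_mem_dist_le (K L : NonemptyCompacts X) {x : X} (hx : x ∈ (K : Set X)) :
    ∃ y ∈ (L : Set X), dist x y ≤ dist K L := by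
  obtain ⟨y, hy, hxy⟩ := L.isCompact.exists_infDist_eq_dist L.nonempty x
  refine ⟨y, hy, ?_⟩
  rw [← hxy, NonemptyCompacts.dist_eq]
  exact infDist_le_hausdorffDist_of_mem hx
    (hausdorffEDist_ne_top_of_nonempty_of_bounded K.nonempty L.nonempty
      K.isCompact.isBounded L.isCompact.isBounded)

lemma dist_le_of_mem_dist {K L : NonemptyCompacts X} {c : ℝ} (hc : 0 ≤ c)
    (h₁ : ∀ x ∈ (K : Set X), ∃ y ∈ (L : Set X), dist x y ≤ c)
    (h₂ : ∀ y ∈ (L : Set X), ∃ x ∈ (K : Set X), dist y x ≤ c) : dist K L ≤ c := by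
  rw [NonemptyCompacts.dist_eq]
  exact hausdorffDist_le_of_mem_dist hc h₁ h₂

lemma dist_singletonNC_le {q : X} {K : NonemptyCompacts X} {c : ℝ}
    (h : ∀ x ∈ (K : Set X), dist q x ≤ c) : dist (singletonNC q) K ≤ c := by
  obtain ⟨x, hx⟩ := K.nonempty
  refine dist_le_of_mem_dist (dist_nonneg.trans (h x hx)) ?_ ?_
  · rintro _ rfl
    exact ⟨x, hx, h x hx⟩
  · exact fun y hy => ⟨q, rfl, by rw [dist_comm]; exact h y hy⟩

lemma dist_le_dist_singletonNC {q : X} {K : NonemptyCompacts X} {x : X}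
    (hx : x ∈ (K : Set X)) : dist q x ≤ dist (singletonNC q) K := by
  obtain ⟨y, hy, hxy⟩ := exists_mem_dist_le K (singletonNC q) hx
  obtain rfl : y = q := hy
  rwa [dist_comm, dist_comm (singletonNC y)]

lemma exists_dist_eq_dist_singletonNC (q : X) (K : NonemptyCompacts X) :
    ∃ x ∈ (K : Set X), dist q x = dist (singletonNC q) K := by
  obtain ⟨x, hx, hmax⟩ := K.isCompact.exists_isMaxOn K.nonempty
    (f := fun x => dist q x) (by fun_prop)
  exact ⟨x, hx, (dist_le_dist_singletonNC hx).antisymm (dist_singletonNC_le hmax)⟩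

/-- If `L ⊆ K` and every point of `K` is at distance less than `r` from `L`, then the
Hausdorff distance is less than `r`. -/
lemma dist_lt_of_subset {K L : NonemptyCompacts X} {r : ℝ} (hLK : (L : Set X) ⊆ K)
    (h : ∀ x ∈ (K : Set X), ∃ y ∈ (L : Set X), dist x y < r) : dist K L < r := by
  obtain ⟨x, hx, hmax⟩ := K.isCompact.exists_isMaxOn K.nonempty
    (f := fun x => infDist x (L : Set X)) (continuous_infDist_pt _).continuousOn
  obtain ⟨y, hy, hxy⟩ := h x hx
  refine lt_of_le_of_lt (dist_le_of_mem_dist (infDist_nonneg (x := x)) ?_ ?_)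
    ((infDist_le_dist_of_mem hy).trans_lt hxy)
  · intro z hz
    obtain ⟨w, hw, hzw⟩ := L.isCompact.exists_infDist_eq_dist L.nonempty z
    exact ⟨w, hw, hzw ▸ hmax hz⟩
  · exact fun z hz => ⟨z, hLK hz, by simpa using infDist_nonneg⟩

/-- Insert a point into a nonempty compact set. -/
def insertPoint (x : X) (K : NonemptyCompacts X) : NonemptyCompacts X :=
  ⟨⟨insert x (K : Set X), K.isCompact.insert x⟩, Set.insert_nonempty _ _⟩

@[simp] lemma coe_insertPoint (x : X) (K : NonemptyCompacts X) :
    (insertPoint x K : Set X) = insert x (K : Set X) := rfl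

end TopologicalSpace.NonemptyCompacts

open TopologicalSpace.NonemptyCompacts

section SphereTrace

variable [MetricSpace X]

/-- The compact sets contained in the closed ball of radius `r` about `p` and meeting the
sphere exactly in `S` (for `S` contained in that sphere). -/
def sphereTraceClass (p : X) (r : ℝ) (S : NonemptyCompacts X) : Set (NonemptyCompacts X) :=
  {K | (S : Set X) ⊆ K ∧ (K : Set X) ⊆ S ∪ ball p r}

/-- `U` is an ultrametric center of `F` if `d(K, L) ≤ max (d(K, U)) (d(L, U))` on `F`. -/
def IsUltrametricCenter {Y : Type*} [MetricSpace Y] (F : Set Y) (U : Y) : Prop :=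
  U ∈ F ∧ ∀ K ∈ F, ∀ L ∈ F, dist K L ≤ max (dist K U) (dist L U)

variable {p : X} {r : ℝ} {S : NonemptyCompacts X}

lemma self_mem_sphereTraceClass : S ∈ sphereTraceClass p r S :=
  ⟨subset_rfl, subset_union_left⟩

lemma insertPoint_mem_sphereTraceClass {x : X} {K : NonemptyCompacts X}
    (hK : K ∈ sphereTraceClass p r S) (hx : x ∈ ball p r) :
    insertPoint x K ∈ sphereTraceClass p r S := by
  refine ⟨hK.1.trans (subset_insert _ _), ?_⟩
  rw [coe_insertPoint]
  exact insert_subset (Or.inr hx) hK.2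

lemma dist_le_of_mem_sphereTraceClass (hS : (S : Set X) ⊆ sphere p r) {K : NonemptyCompacts X}
    (hK : K ∈ sphereTraceClass p r S) {x : X} (hx : x ∈ (K : Set X)) : dist p x ≤ r := by
  rw [dist_comm]
  rcases hK.2 hx with h | h
  · exact (mem_sphere.1 (hS h)).le
  · exact (mem_ball.1 h).le

/-- Seen from a suitable point beyond `p`, a point `s` of the sphere is the unique farthest point
of the closed ball, so membership of `s` is detected by the distance to singletons. -/
lemma mem_of_dist_singletonNC_eq (hug : IsUniquelyGeodesic X) (hgc : IsGeodesicallyComplete X)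
    (hns : GeodesicsDoNotSplit X) {s : X} (hs : dist p s = r) {K L : NonemptyCompacts X}
    (hL : ∀ x ∈ (L : Set X), dist p x ≤ r)
    (hKL : ∀ q, dist (singletonNC q) K = dist (singletonNC q) L) (hsK : s ∈ (K : Set X)) :
    s ∈ (L : Set X) := by
  obtain ⟨γ, hγ, h0, h1⟩ := exists_line hug hgc p s
  have hr : 0 ≤ r := hs ▸ dist_nonneg
  rw [hs] at h1
  set q := γ (-1) with hq
  have hqp : dist q p = 1 := by rw [hq, ← h0, hγ.dist_eq, Real.dist_eq]; norm_num
  have hqs : dist q s = 1 + r := by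
    rw [hq, ← h1, hγ.dist_eq, Real.dist_eq, abs_of_nonpos (by linarith)]; ring
  obtain ⟨x, hx, hqx⟩ := exists_dist_eq_dist_singletonNC q L
  have h2 : 1 + r ≤ dist q x := by
    rw [hqx, ← hKL, ← hqs]
    exact dist_le_dist_singletonNC hsK
  have h3 := dist_triangle q p x
  have h4 := hL x hx
  have hqne : q ≠ p := by
    intro h
    rw [h, dist_self] at hqp
    norm_num at hqp
  have : x = s := eq_of_dist_add_eq hug hgc hns hqne (by linarith) (by linarith) (by linarith)
  exact this ▸ hx

lemma mem_sphereTraceClass_of_dist_singletonNC_eq (hug : IsUniquelyGeodesic X)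
    (hgc : IsGeodesicallyComplete X) (hns : GeodesicsDoNotSplit X)
    (hS : (S : Set X) ⊆ sphere p r) {K L : NonemptyCompacts X}
    (hK : K ∈ sphereTraceClass p r S)
    (hKL : ∀ q, dist (singletonNC q) K = dist (singletonNC q) L) :
    L ∈ sphereTraceClass p r S := by
  have hKr : ∀ x ∈ (K : Set X), dist p x ≤ r :=
    fun x hx => dist_le_of_mem_sphereTraceClass hS hK hx
  have hLr : ∀ x ∈ (L : Set X), dist p x ≤ r := fun x hx =>
    (dist_le_dist_singletonNC hx).trans (hKL p ▸ dist_singletonNC_le hKr)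
  refine ⟨fun s hs => ?_, fun x hx => ?_⟩
  · exact mem_of_dist_singletonNC_eq hug hgc hns (by rw [dist_comm]; exact hS hs) hLr hKL
      (hK.1 hs)
  · rcases (hLr x hx).lt_or_eq with h | h
    · exact Or.inr (by rwa [mem_ball, dist_comm])
    · exact hK.2 (mem_of_dist_singletonNC_eq hug hgc hns h hKr (fun q => (hKL q).symm) hx)

lemma isUltrametricCenter_self : IsUltrametricCenter (sphereTraceClass p r S) S := by
  have key : ∀ K : NonemptyCompacts X, ∀ L ∈ sphereTraceClass p r S,
      ∀ x ∈ (K : Set X), ∃ y ∈ (L : Set X), dist x y ≤ dist K S := by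
    intro K L hL x hx
    obtain ⟨y, hy, hxy⟩ := exists_mem_dist_le K S hx
    exact ⟨y, hL.1 hy, hxy⟩
  refine ⟨self_mem_sphereTraceClass, fun K hK L hL => ?_⟩
  refine dist_le_of_mem_dist (le_max_of_le_left dist_nonneg) (fun x hx => ?_) fun y hy => ?_
  · obtain ⟨y, hy, h⟩ := key K L hL x hx
    exact ⟨y, hy, le_max_of_le_left h⟩
  · obtain ⟨x, hx, h⟩ := key L K hK y hy
    exact ⟨x, hx, le_max_of_le_right h⟩

/-- No point of the open ball outside an ultrametric center has a nearest point of the center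
in the open ball. -/
lemma IsUltrametricCenter.mem_of_forall_dist_le (hug : IsUniquelyGeodesic X)
    (hgc : IsGeodesicallyComplete X) (hns : GeodesicsDoNotSplit X) {U : NonemptyCompacts X}
    (hU : IsUltrametricCenter (sphereTraceClass p r S) U) {x u : X} (hu : u ∈ (U : Set X))
    (huS : u ∉ (S : Set X)) (hxu : ∀ v ∈ (U : Set X), dist x u ≤ dist x v) :
    x ∈ (U : Set X) := by
  by_contra hxU
  have hub : u ∈ ball p r := (hU.1.2 hu).resolve_left huS
  have hD : 0 < dist u x := dist_pos.2 fun h => hxU (h ▸ hu)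
  obtain ⟨γ, hγ, h0, h1⟩ := exists_line hug hgc u x
  obtain ⟨ε, hε, hεS⟩ := Metric.isOpen_iff.1 S.isCompact.isClosed.isOpen_compl u huS
  obtain ⟨ε', hε', hεb⟩ := Metric.isOpen_iff.1 (isOpen_ball (x := p) (ε := r)) u hub
  obtain ⟨ξ, hξ, hξlt⟩ := exists_between (lt_min (lt_min hε hε') hD)
  obtain ⟨⟨hξε, hξε'⟩, hξD⟩ : (ξ < ε ∧ ξ < ε') ∧ ξ < dist u x := by
    simpa only [lt_min_iff] using hξlt
  set z := γ ξ with hz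
  set y := γ (-(ξ / 2)) with hy
  have hzu : dist z u = ξ := by
    rw [hz, ← h0, hγ.dist_eq, Real.dist_eq, sub_zero, abs_of_pos hξ]
  have hyu : dist y u = ξ / 2 := by
    rw [hy, ← h0, hγ.dist_eq, Real.dist_eq, sub_zero, abs_neg, abs_of_pos (by linarith)]
  have hzy : dist z y = 3 * ξ / 2 := by
    rw [hz, hy, hγ.dist_eq, Real.dist_eq, abs_of_pos (by linarith)]; ring
  have hxz : dist x z = dist u x - ξ := by
    nth_rewrite 1 [← h1]
    rw [hz, hγ.dist_eq, Real.dist_eq, abs_of_pos (by linarith)]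
  have hzb : z ∈ ball p r := hεb (by rw [mem_ball]; linarith)
  have hyb : y ∈ ball p r := hεb (by rw [mem_ball]; linarith)
  have hfar : ∀ v ∈ (U : Set X), v ≠ u → ξ < dist z v := by
    intro v hv hvu
    by_contra! hle
    have h2 := hxu v hv
    have h3 := dist_triangle x z v
    rw [dist_comm x u] at h2
    have hxzne : x ≠ z := dist_pos.1 (by linarith)
    exact hvu (eq_of_dist_add_eq hug hgc hns hxzne (by linarith)
      (by rw [dist_comm x u]; linarith) (by linarith))
  let K : NonemptyCompacts X :=
    ⟨⟨insert y ((U : Set X) \ ball u (ξ / 4)), (U.isCompact.diff isOpen_ball).insert y⟩,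
      Set.insert_nonempty _ _⟩
  have hKcoe : (K : Set X) = insert y ((U : Set X) \ ball u (ξ / 4)) := rfl
  have hKF : K ∈ sphereTraceClass p r S := by
    refine ⟨fun s hs => Or.inr ⟨hU.1.1 hs, fun hsb => ?_⟩, ?_⟩
    · exact hεS (ball_subset_ball (by linarith) hsb) hs
    · rw [hKcoe]
      exact insert_subset (Or.inr hyb) (sdiff_subset.trans hU.1.2)
  have hLF : insertPoint z U ∈ sphereTraceClass p r S := insertPoint_mem_sphereTraceClass hU.1 hzb
  have hKU : dist K U ≤ ξ := by
    refine dist_le_of_mem_dist hξ.le ?_ ?_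
    · rintro v (rfl | hv)
      · exact ⟨u, hu, by linarith⟩
      · exact ⟨v, hv.1, by rw [dist_self]; exact hξ.le⟩
    · intro v hv
      by_cases hvb : v ∈ ball u (ξ / 4)
      · refine ⟨y, Or.inl rfl, ?_⟩
        have h2 := dist_triangle v u y
        rw [dist_comm u y] at h2
        rw [mem_ball] at hvb
        linarith
      · exact ⟨v, Or.inr ⟨hv, hvb⟩, by rw [dist_self]; exact hξ.le⟩
  have hLU : dist (insertPoint z U) U ≤ ξ := by
    refine dist_le_of_mem_dist hξ.le ?_ ?_
    · rintro v (rfl | hv)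
      · exact ⟨u, hu, hzu.le⟩
      · exact ⟨v, hv, by rw [dist_self]; exact hξ.le⟩
    · exact fun v hv => ⟨v, Or.inr hv, by rw [dist_self]; exact hξ.le⟩
  have hLK := (hU.2 _ hLF _ hKF).trans (max_le hLU hKU)
  obtain ⟨k, hk, hzk⟩ := exists_mem_dist_le (insertPoint z U) K (x := z) (Or.inl rfl)
  rcases hk with rfl | hk
  · linarith
  · refine absurd (hzk.trans hLK) (not_le.2 (hfar k hk.1 ?_))
    rintro rfl
    exact hk.2 (mem_ball_self (by linarith))

/-- The only candidates for ultrametric centers are `S` and the full closed ball. -/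
lemma IsUltrametricCenter.closedBall_subset (hug : IsUniquelyGeodesic X)
    (hgc : IsGeodesicallyComplete X) (hns : GeodesicsDoNotSplit X) (hr : 0 < r)
    (hS : (S : Set X) ⊆ sphere p r) {U : NonemptyCompacts X}
    (hU : IsUltrametricCenter (sphereTraceClass p r S) U) (hne : U ≠ S) :
    closedBall p r ⊆ (U : Set X) := by
  have hopen : ∀ u ∈ (U : Set X), u ∉ (S : Set X) → u ∈ interior (U : Set X) := by
    intro u hu huS
    obtain ⟨ε, hε, hεS⟩ := Metric.isOpen_iff.1 S.isCompact.isClosed.isOpen_compl u huS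
    rw [mem_interior_iff_mem_nhds, Metric.mem_nhds_iff]
    refine ⟨ε / 2, by linarith, fun x hx => ?_⟩
    obtain ⟨v, hv, hxv⟩ := U.isCompact.exists_infDist_eq_dist U.nonempty x
    have hmin : ∀ w ∈ (U : Set X), dist x v ≤ dist x w :=
      fun w hw => hxv ▸ infDist_le_dist_of_mem hw
    refine hU.mem_of_forall_dist_le hug hgc hns hv (hεS ?_) hmin
    have h1 := hmin u hu
    have h2 := dist_triangle_left v u x
    rw [mem_ball] at hx ⊢
    linarith
  obtain ⟨u, hu, huS⟩ : ∃ u ∈ (U : Set X), u ∉ (S : Set X) := by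
    by_contra! h
    exact hne (SetLike.coe_injective (Subset.antisymm h hU.1.1))
  refine closedBall_subset_of_ball_subset hug hgc hr U.isCompact.isClosed fun x hx => ?_
  by_contra hxU
  have hdisj : ∀ z ∈ ball p r, z ∉ (S : Set X) :=
    fun z hz hzS => (mem_ball.1 hz).ne (mem_sphere.1 (hS hzS))
  have hcover : ball p r ⊆ interior (U : Set X) ∪ (U : Set X)ᶜ := by
    intro z hz
    by_cases hzU : z ∈ (U : Set X)
    · exact Or.inl (hopen z hzU (hdisj z hz))
    · exact Or.inr hzU
  obtain ⟨z, _, hz, hz'⟩ := isPreconnected_ball_of_geodesic hug hgc p r _ _ isOpen_interior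
    U.isCompact.isClosed.isOpen_compl hcover
    ⟨u, (hU.1.2 hu).resolve_left huS, hopen u hu huS⟩ ⟨x, hx, hxU⟩
  exact hz' (interior_subset hz)

/-- If the full closed ball belongs to the class, then `S` is the only member at
distance at least `r` from it. -/
lemma eq_of_le_dist_of_closedBall_subset (hug : IsUniquelyGeodesic X)
    (hgc : IsGeodesicallyComplete X) (hr : 0 < r) (hS : (S : Set X) ⊆ sphere p r)
    {U L : NonemptyCompacts X} (hU : U ∈ sphereTraceClass p r S)
    (hUb : closedBall p r ⊆ (U : Set X)) (hL : L ∈ sphereTraceClass p r S)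
    (h : r ≤ dist U L) : L = S := by
  by_contra hne
  obtain ⟨l, hl, hlS⟩ : ∃ l ∈ (L : Set X), l ∉ (S : Set X) := by
    by_contra! h
    exact hne (SetLike.coe_injective (Subset.antisymm h hL.1))
  have hlb : l ∈ ball p r := (hL.2 hl).resolve_left hlS
  refine h.not_gt (dist_lt_of_subset (fun x hx => hUb ?_) fun x hx => ?_)
  · rw [mem_closedBall, dist_comm]
    exact dist_le_of_mem_sphereTraceClass hS hL hx
  · by_cases hxp : p = x
    · subst hxp
      exact ⟨l, hl, by rwa [dist_comm]⟩
    · have hpx : 0 < dist p x := dist_pos.2 hxp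
      have hxr := dist_le_of_mem_sphereTraceClass hS hU hx
      obtain ⟨γ, hγ, h0, h1⟩ := exists_line hug hgc p x
      have hs : dist (γ r) p = r := by
        rw [← h0, hγ.dist_eq, Real.dist_eq, sub_zero, abs_of_pos hr]
      have hsS : γ r ∈ (S : Set X) := by
        refine (hU.2 (hUb (mem_closedBall.2 hs.le))).resolve_right fun hb => ?_
        exact (mem_ball.1 hb).ne hs
      refine ⟨γ r, hL.1 hsS, ?_⟩
      nth_rewrite 1 [← h1]
      rw [hγ.dist_eq, Real.dist_eq, abs_of_nonpos (by linarith)]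
      linarith

lemma le_dist_of_center_mem (hS : (S : Set X) ⊆ sphere p r) {K : NonemptyCompacts X}
    (hp : p ∈ (K : Set X)) : r ≤ dist S K := by
  obtain ⟨s, hs, h⟩ := exists_mem_dist_le K S hp
  rw [dist_comm S K, ← mem_sphere.1 (hS hs), dist_comm s p]
  exact h

/-- A self-isometry of the compact sets fixing all singletons fixes every compact subset of a
sphere. -/
theorem fixes_compact_subset_of_sphere [ProperSpace X] (hug : IsUniquelyGeodesic X)
    (hgc : IsGeodesicallyComplete X) (hns : GeodesicsDoNotSplit X)
    (J : NonemptyCompacts X ≃ᵢ NonemptyCompacts X)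
    (hJ : ∀ p : X, J (singletonNC p) = singletonNC p) (hr : 0 < r)
    (hS : (S : Set X) ⊆ sphere p r) : J S = S := by
  have hdist : ∀ (K : NonemptyCompacts X) (q : X),
      dist (singletonNC q) K = dist (singletonNC q) (J K) := by
    intro K q
    nth_rewrite 2 [← hJ q]
    exact (J.dist_eq _ _).symm
  have hJF : ∀ K ∈ sphereTraceClass p r S, J K ∈ sphereTraceClass p r S := fun K hK =>
    mem_sphereTraceClass_of_dist_singletonNC_eq hug hgc hns hS hK (hdist K)
  have hJF' : ∀ K ∈ sphereTraceClass p r S, J.symm K ∈ sphereTraceClass p r S := fun K hK =>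
    mem_sphereTraceClass_of_dist_singletonNC_eq hug hgc hns hS hK fun q => by
      rw [hdist (J.symm K) q, J.apply_symm_apply]
  have hU : IsUltrametricCenter (sphereTraceClass p r S) (J S) := by
    refine ⟨hJF S self_mem_sphereTraceClass, fun K hK L hL => ?_⟩
    have h := isUltrametricCenter_self.2 _ (hJF' K hK) _ (hJF' L hL)
    rwa [← J.dist_eq, ← J.dist_eq (J.symm K), ← J.dist_eq (J.symm L), J.apply_symm_apply,
      J.apply_symm_apply] at h
  by_contra hne
  have hball := hU.closedBall_subset hug hgc hns hr hS hne
  have hfix : ∀ K ∈ sphereTraceClass p r S, p ∈ (K : Set X) → J K = S := fun K hK hp =>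
    eq_of_le_dist_of_closedBall_subset hug hgc hr hS hU.1 hball (hJF K hK)
      (by rw [J.dist_eq]; exact le_dist_of_center_mem hS hp)
  obtain ⟨s, hs⟩ := S.nonempty
  have hps : dist p s = r := by rw [dist_comm]; exact hS hs
  obtain ⟨γ, hγ, h0, -⟩ := exists_line hug hgc p s
  have hm : dist (γ (r / 2)) p = r / 2 := by
    rw [← h0, hγ.dist_eq, Real.dist_eq, sub_zero, abs_of_pos (by linarith)]
  have hK₁ : insertPoint p S ∈ sphereTraceClass p r S :=
    insertPoint_mem_sphereTraceClass self_mem_sphereTraceClass (mem_ball_self hr)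
  have hK₂ : insertPoint (γ (r / 2)) (insertPoint p S) ∈ sphereTraceClass p r S :=
    insertPoint_mem_sphereTraceClass hK₁ (by rw [mem_ball]; linarith)
  have heq : insertPoint (γ (r / 2)) (insertPoint p S) = insertPoint p S :=
    J.injective ((hfix _ hK₂ (Or.inr (Or.inl rfl))).trans (hfix _ hK₁ (Or.inl rfl)).symm)
  have hmem : γ (r / 2) ∈ (insertPoint p S : Set X) := by
    rw [← heq]
    exact Or.inl rfl
  rcases hmem with h | h
  · rw [h, dist_self] at hm
    linarith
  · have := mem_sphere.1 (hS h)
    linarith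

end SphereTrace

/-- **Lemma 5.3.** A surjective isometry of `𝔉(X,d)` fixing all singletons fixes
every nonempty finite subset of a sphere. -/
theorem fixing_points_fixes_finite_subsets_of_spheres [MetricSpace X] [ProperSpace X]
    (hug : IsUniquelyGeodesic X) (hgc : IsGeodesicallyComplete X)
    (hns : GeodesicsDoNotSplit X)
    (J : NonemptyCompacts X ≃ᵢ NonemptyCompacts X)
    (hJ : ∀ p : X, J (singletonNC p) = singletonNC p) :
    ∀ (p : X) (r : ℝ), 0 < r → ∀ S : NonemptyCompacts X,
      (S : Set X).Finite → (S : Set X) ⊆ Metric.sphere p r → J S = S := by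
  intro p r hr S _ hS
  exact fixes_compact_subset_of_sphere hug hgc hns J hJ hr hS
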